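/- Let d ≥ 2, 1 < p < ∞ and C₀ > 0, let V be a locally bounded measurable function on B_1 \ {0} ⊆ ℝ^d satisfying ‖x‖^p |V(x)| ≤ C₀ almost everywhere, and let u, v be positive C¹ weak solutions of -Δ_p w + V|w|^{p-2}w = 0 in B_1 \ {0}. For 0 < r < 1 define m_r := inf_{‖x‖ = r} u(x)/v(x) and M_r := sup_{‖x‖ = r} u(x)/v(x). Then there exists r₀ ∈ (0, 1) such that the function r ↦ m_r is monotone (either nondecreasing or nonincreasing) on (0, r₀) and likewise the function r ↦ M_r is monotone on (0, r₀); in particular the limits lim_{r → 0+} m_r and lim_{r → 0+} M_r exist in the extended interval [0, +∞]. -/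

import Mathlib

open MeasureTheory Metric Filter Topology Set
open scoped RealInnerProductSpace ENNReal

noncomputable section

/-- `u` is a positive `C¹` weak solution of `-Δ_p u + V|u|^{p-2}u = 0` in the open set `Ω`. -/
def IsPosWeakSol {d : ℕ} (p : ℝ) (V : EuclideanSpace ℝ (Fin d) → ℝ)
    (Ω : Set (EuclideanSpace ℝ (Fin d))) (u : EuclideanSpace ℝ (Fin d) → ℝ) : Prop :=
  ContDiffOn ℝ 1 u Ω ∧ (∀ x ∈ Ω, 0 < u x) ∧
  ∀ φ : EuclideanSpace ℝ (Fin d) → ℝ, ContDiff ℝ (⊤ : ℕ∞) φ → HasCompactSupport φ →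
    tsupport φ ⊆ Ω →
    ∫ x in Ω, (‖gradient u x‖ ^ (p - 2) * ⟪gradient u x, gradient φ x⟫ +
      V x * |u x| ^ (p - 2) * u x * φ x) = 0

theorem exists_smooth_approx {d : ℕ} {Ω : Set (EuclideanSpace ℝ (Fin d))} (hΩ : IsOpen Ω)
    {φ : EuclideanSpace ℝ (Fin d) → ℝ} (hφ : ContDiff ℝ 1 φ) (hc : HasCompactSupport φ)
    (hs : tsupport φ ⊆ Ω) :
    ∃ K : Set (EuclideanSpace ℝ (Fin d)), IsCompact K ∧ K ⊆ Ω ∧ tsupport φ ⊆ K ∧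
      ∀ ε > 0, ∃ ψ : EuclideanSpace ℝ (Fin d) → ℝ, ContDiff ℝ (⊤ : ℕ∞) ψ ∧ tsupport ψ ⊆ K ∧
        ∀ x, dist (ψ x) (φ x) ≤ ε ∧ dist (fderiv ℝ ψ x) (fderiv ℝ φ x) ≤ ε := by
  obtain ⟨δ₀, hδ₀, hK⟩ := hc.isCompact.exists_cthickening_subset_open hΩ hs
  refine ⟨cthickening δ₀ (tsupport φ), hc.isCompact.cthickening, hK, self_subset_cthickening _, ?_⟩
  intro ε hε
  have hd0 : Continuous (fderiv ℝ φ) := hφ.continuous_fderiv one_ne_zero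
  have hu0 := hc.uniformContinuous_of_continuous hφ.continuous
  have hu1 := (hc.fderiv (𝕜 := ℝ)).uniformContinuous_of_continuous hd0
  obtain ⟨δ₁, hδ₁, h₁⟩ := Metric.uniformContinuous_iff.1 hu0 ε hε
  obtain ⟨δ₂, hδ₂, h₂⟩ := Metric.uniformContinuous_iff.1 hu1 ε hε
  let δ := min δ₀ (min δ₁ δ₂)
  have hδ : 0 < δ := lt_min hδ₀ (lt_min hδ₁ hδ₂)
  let B : ContDiffBump (0 : EuclideanSpace ℝ (Fin d)) := ⟨δ / 2, δ, half_pos hδ, half_lt_self hδ⟩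
  have hB : B.rOut = δ := rfl
  let ψ := convolution (B.normed volume) φ (ContinuousLinearMap.lsmul ℝ ℝ) volume
  have hψ' : ∀ x, HasFDerivAt ψ (convolution (B.normed volume) (fderiv ℝ φ)
      (ContinuousLinearMap.lsmul ℝ ℝ) volume x) x := by
    intro x
    have := hc.hasFDerivAt_convolution_right (ContinuousLinearMap.lsmul ℝ ℝ)
      (μ := volume) (f := B.normed volume) B.continuous_normed.locallyIntegrable hφ x
    exact this
  refine ⟨ψ, B.hasCompactSupport_normed.contDiff_convolution_left _ B.contDiff_normed
    hφ.continuous.locallyIntegrable, ?_, fun x => ⟨?_, ?_⟩⟩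
  · refine closure_minimal (fun x hx => ?_) isClosed_cthickening
    by_contra hxK
    refine hx (dist_le_zero.1 ?_)
    have hz : ∀ y ∈ ball x B.rOut, φ y = 0 := by
      intro y hy
      by_contra hne
      refine hxK (mem_cthickening_of_dist_le x y _ _ (subset_closure hne) ?_)
      rw [dist_comm]
      exact (mem_ball.1 hy).le.trans (min_le_left _ _)
    have hx0 := hz x (mem_ball_self hδ)
    have := B.dist_normed_convolution_le (μ := volume) (g := φ) (x₀ := x) (ε := 0)
      hφ.continuous.aestronglyMeasurable (fun y hy => by rw [hz y hy, hx0, dist_self])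
    rwa [hx0] at this
  · refine B.dist_normed_convolution_le hφ.continuous.aestronglyMeasurable fun y hy => (h₁ ?_).le
    exact (mem_ball.1 hy).trans_le ((min_le_right _ _).trans (min_le_left _ _))
  · rw [(hψ' x).fderiv]
    refine B.dist_normed_convolution_le hd0.aestronglyMeasurable fun y hy => (h₂ ?_).le
    exact (mem_ball.1 hy).trans_le ((min_le_right _ _).trans (min_le_right _ _))

theorem norm_rpow_sub_two_mul_sq {E : Type*} [NormedAddCommGroup E] {p : ℝ} (hp : 1 < p) (a : E) :
    ‖a‖ ^ (p - 2) * ‖a‖ ^ 2 = ‖a‖ ^ p := by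
  rcases eq_or_ne a 0 with rfl | ha
  · simp [Real.zero_rpow (by linarith : p ≠ 0)]
  · rw [← Real.rpow_natCast, ← Real.rpow_add (norm_pos_iff.2 ha)]
    norm_num

section InnerInequalities

variable {E : Type*} [NormedAddCommGroup E] [InnerProductSpace ℝ E]

theorem inner_rpow_smul_sub_pos {p : ℝ} (hp : 1 < p) {a b : E} (hab : a ≠ b) :
    0 < ⟪‖a‖ ^ (p - 2) • a - ‖b‖ ^ (p - 2) • b, a - b⟫ := by
  rcases eq_or_ne a 0 with rfl | ha
  · have hb : 0 < ‖b‖ := norm_pos_iff.2 hab.symm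
    simp only [smul_zero, zero_sub, inner_neg_neg, real_inner_smul_left, real_inner_self_eq_norm_sq]
    positivity
  rcases eq_or_ne b 0 with rfl | hb
  · have hb : 0 < ‖a‖ := norm_pos_iff.2 hab
    simp only [smul_zero, sub_zero, real_inner_smul_left, real_inner_self_eq_norm_sq]
    positivity
  have hs : 0 < ‖a‖ := norm_pos_iff.2 ha
  have ht : 0 < ‖b‖ := norm_pos_iff.2 hb
  have hc : ⟪a, b⟫ ≤ ‖a‖ * ‖b‖ := real_inner_le_norm a b
  have hsub : 0 < ‖a - b‖ ^ 2 := by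
    have := norm_pos_iff.2 (sub_ne_zero.2 hab)
    positivity
  rw [norm_sub_sq_real] at hsub
  simp only [inner_sub_left, inner_sub_right, real_inner_smul_left, real_inner_self_eq_norm_sq,
    real_inner_comm a b]
  generalize ⟪a, b⟫ = c at *
  generalize ‖a‖ = s at *
  generalize ‖b‖ = t at *
  have hs2 : 0 < s ^ (p - 2) := Real.rpow_pos_of_pos hs _
  have ht2 : 0 < t ^ (p - 2) := Real.rpow_pos_of_pos ht _
  rcases eq_or_ne s t with rfl | hst
  · nlinarith [mul_pos hs2 hsub]
  have h1 : ∀ x : ℝ, 0 < x → x ^ (p - 2) * x = x ^ (p - 1) := fun x hx => by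
    rw [← Real.rpow_add_one hx.ne']; ring_nf
  have key : 0 < (s ^ (p - 1) - t ^ (p - 1)) * (s - t) := by
    rcases lt_or_gt_of_ne hst with h | h
    · have := Real.rpow_lt_rpow hs.le h (by linarith : 0 < p - 1)
      exact mul_pos_of_neg_of_neg (by linarith) (by linarith)
    · have := Real.rpow_lt_rpow ht.le h (by linarith : 0 < p - 1)
      exact mul_pos (by linarith) (by linarith)
  rw [← h1 s hs, ← h1 t ht] at key
  nlinarith [mul_nonneg (add_pos hs2 ht2).le (sub_nonneg.2 hc)]

theorem mul_rpow_mul_inner_le {p : ℝ} (hp : 1 < p) (a b : E) :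
    p * (‖b‖ ^ (p - 2) * ⟪b, a⟫) ≤ ‖a‖ ^ p + (p - 1) * ‖b‖ ^ p := by
  rcases eq_or_ne b 0 with rfl | hb
  · simp only [inner_zero_left, mul_zero, norm_zero]
    rw [Real.zero_rpow (by linarith)]
    simpa using Real.rpow_nonneg (norm_nonneg a) p
  have ht : 0 < ‖b‖ := norm_pos_iff.2 hb
  have hq := Real.HolderConjugate.conjExponent hp
  have hy := Real.young_inequality_of_nonneg (norm_nonneg a)
    (Real.rpow_nonneg (norm_nonneg b) (p - 1)) hq
  rw [← Real.rpow_mul (norm_nonneg b), hq.sub_one_mul_conj] at hy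
  have hp0 : 0 < p := by linarith
  have h1 : ‖b‖ ^ (p - 2) * ⟪b, a⟫ ≤ ‖a‖ * ‖b‖ ^ (p - 1) := by
    calc _ ≤ ‖b‖ ^ (p - 2) * (‖b‖ * ‖a‖) := by gcongr; exact real_inner_le_norm b a
      _ = ‖a‖ * (‖b‖ ^ (p - 2) * ‖b‖) := by ring
      _ = _ := by rw [← Real.rpow_add_one ht.ne']; ring_nf
  calc _ ≤ p * (‖a‖ ^ p / p + ‖b‖ ^ p / p.conjExponent) := by gcongr; exact h1.trans hy
    _ = _ := by
      rw [Real.conjExponent]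
      have : p - 1 ≠ 0 := by linarith
      field_simp

end InnerInequalities

theorem exists_monotoneOn_or_antitoneOn_of_min_le {α : Type*} [LinearOrder α] {f : ℝ → α}
    (hf : ∀ a b c, 0 < a → a < b → b < c → c < 1 → min (f a) (f c) ≤ f b) :
    ∃ r₀ : ℝ, 0 < r₀ ∧ r₀ < 1 ∧ ∀ r, r ≤ r₀ →
      (MonotoneOn f (Ioo 0 r) ∨ AntitoneOn f (Ioo 0 r)) := by
  by_cases h : ∃ r₀ : ℝ, 0 < r₀ ∧ r₀ < 1 ∧ MonotoneOn f (Ioo 0 r₀)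
  · obtain ⟨r₀, h0, h1, h2⟩ := h
    exact ⟨r₀, h0, h1, fun r hr => Or.inl (h2.mono (Ioo_subset_Ioo_right hr))⟩
  · refine ⟨1 / 2, by norm_num, by norm_num, fun r hr => Or.inr fun x hx y hy hxy => ?_⟩
    by_contra! hlt
    refine h ⟨x, hx.1, by linarith [hx.2], fun a ha b hb hab => ?_⟩
    by_contra! hba
    have hab' : a < b := lt_of_le_of_ne hab (by rintro rfl; exact hba.false)
    have hxy' : x < y := lt_of_le_of_ne hxy (by rintro rfl; exact hlt.false)
    have h1 := hf a b x ha.1 hab' hb.2 (by linarith [hx.2])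
    have h2 := hf a x y ha.1 (hab'.trans hb.2) hxy' (by linarith [hy.2])
    have h3 : f x ≤ f b := (min_le_iff.1 h1).resolve_left (not_le.2 hba)
    exact (lt_min (h3.trans_lt hba) hlt).not_ge h2

section Flux

variable {d : ℕ} {Ω K : Set (EuclideanSpace ℝ (Fin d))}
  {F : EuclideanSpace ℝ (Fin d) → EuclideanSpace ℝ (Fin d)} {G : EuclideanSpace ℝ (Fin d) → ℝ}

theorem gradient_eq_zero_of_notMem_tsupport {φ : EuclideanSpace ℝ (Fin d) → ℝ}
    {x : EuclideanSpace ℝ (Fin d)} (hx : x ∉ tsupport φ) : gradient φ x = 0 := by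
  have : fderiv ℝ φ x = 0 := by
    by_contra h
    exact hx (support_fderiv_subset ℝ h)
  simp [gradient, this]

theorem norm_gradient_sub (f g : EuclideanSpace ℝ (Fin d) → ℝ) (x : EuclideanSpace ℝ (Fin d)) :
    ‖gradient f x - gradient g x‖ = ‖fderiv ℝ f x - fderiv ℝ g x‖ := by
  rw [gradient, gradient, ← map_sub, LinearIsometryEquiv.norm_map]

theorem continuousOn_gradient {f : EuclideanSpace ℝ (Fin d) → ℝ} (hΩ : IsOpen Ω)
    (hf : ContDiffOn ℝ 1 f Ω) : ContinuousOn (gradient f) Ω :=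
  (LinearIsometryEquiv.continuous _).comp_continuousOn
    (hf.continuousOn_fderiv_of_isOpen hΩ le_rfl)

theorem continuous_gradient {f : EuclideanSpace ℝ (Fin d) → ℝ}
    (hf : ContDiff ℝ 1 f) : Continuous (gradient f) :=
  (LinearIsometryEquiv.continuous _).comp (hf.continuous_fderiv one_ne_zero)

theorem norm_inner_gradient_add_mul_le {C D : ℝ} {φ : EuclideanSpace ℝ (Fin d) → ℝ}
    (hK : ∀ x ∈ K, ‖F x‖ ≤ C ∧ |G x| ≤ C) (hφ : tsupport φ ⊆ K)
    (hD : ∀ x ∈ K, ‖gradient φ x‖ ≤ D ∧ |φ x| ≤ D) (x : EuclideanSpace ℝ (Fin d)) :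
    ‖⟪F x, gradient φ x⟫ + G x * φ x‖ ≤ K.indicator (fun _ => C * D + C * D) x := by
  by_cases hx : x ∈ K
  · rw [indicator_of_mem hx]
    obtain ⟨h1, h2⟩ := hK x hx
    obtain ⟨h3, h4⟩ := hD x hx
    have hC : 0 ≤ C := (norm_nonneg _).trans h1
    refine (norm_add_le _ _).trans (add_le_add ?_ ?_)
    · exact (norm_inner_le_norm _ _).trans (by gcongr)
    · rw [norm_mul, Real.norm_eq_abs, Real.norm_eq_abs]
      gcongr
  · rw [indicator_of_notMem hx, gradient_eq_zero_of_notMem_tsupport fun h => hx (hφ h),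
      image_eq_zero_of_notMem_tsupport fun h => hx (hφ h)]
    simp

theorem aestronglyMeasurable_inner_gradient_add_mul {φ : EuclideanSpace ℝ (Fin d) → ℝ}
    (hF : AEStronglyMeasurable F (volume.restrict Ω))
    (hG : AEStronglyMeasurable G (volume.restrict Ω)) (hφ : ContDiff ℝ 1 φ) :
    AEStronglyMeasurable (fun x => ⟪F x, gradient φ x⟫ + G x * φ x) (volume.restrict Ω) :=
  (hF.inner (continuous_gradient hφ).aestronglyMeasurable).add
    (hG.mul hφ.continuous.aestronglyMeasurable)

theorem integrable_indicator_const_of_isCompact (hK : IsCompact K) (C : ℝ) :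
    Integrable (K.indicator fun _ => C) (volume.restrict Ω) :=
  IntegrableOn.integrable_indicator (integrableOn_const
    ((Measure.restrict_apply_le _ _).trans_lt hK.measure_lt_top).ne) hK.measurableSet

theorem exists_gradient_bound {φ : EuclideanSpace ℝ (Fin d) → ℝ} (hφ : ContDiff ℝ 1 φ)
    (hK : IsCompact K) : ∃ D : ℝ, ∀ x ∈ K, ‖gradient φ x‖ ≤ D ∧ |φ x| ≤ D := by
  obtain ⟨D₁, h₁⟩ := hK.exists_bound_of_continuousOn (continuous_gradient hφ).continuousOn
  obtain ⟨D₂, h₂⟩ := hK.exists_bound_of_continuousOn hφ.continuous.continuousOn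
  exact ⟨max D₁ D₂, fun x hx => ⟨(h₁ x hx).trans (le_max_left _ _),
    (h₂ x hx).trans (le_max_right _ _)⟩⟩

theorem integrable_inner_gradient_add_mul {φ : EuclideanSpace ℝ (Fin d) → ℝ} {C : ℝ}
    (hF : AEStronglyMeasurable F (volume.restrict Ω))
    (hG : AEStronglyMeasurable G (volume.restrict Ω)) (hKc : IsCompact K)
    (hK : ∀ x ∈ K, ‖F x‖ ≤ C ∧ |G x| ≤ C) (hφ : ContDiff ℝ 1 φ) (hs : tsupport φ ⊆ K) :
    Integrable (fun x => ⟪F x, gradient φ x⟫ + G x * φ x) (volume.restrict Ω) := by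
  obtain ⟨D, hD⟩ := exists_gradient_bound hφ hKc
  exact (integrable_indicator_const_of_isCompact hKc (C * D + C * D)).mono'
    (aestronglyMeasurable_inner_gradient_add_mul hF hG hφ)
    (Eventually.of_forall (norm_inner_gradient_add_mul_le hK hs hD))

/-- A first-order distribution with locally bounded coefficients which vanishes on smooth test
functions vanishes on `C¹` test functions. -/
theorem integral_inner_gradient_add_mul_eq_zero {φ : EuclideanSpace ℝ (Fin d) → ℝ}
    (hΩ : IsOpen Ω) (hF : AEStronglyMeasurable F (volume.restrict Ω))
    (hG : AEStronglyMeasurable G (volume.restrict Ω))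
    (hb : ∀ K, IsCompact K → K ⊆ Ω → ∃ C, ∀ x ∈ K, ‖F x‖ ≤ C ∧ |G x| ≤ C)
    (h : ∀ φ : EuclideanSpace ℝ (Fin d) → ℝ, ContDiff ℝ (⊤ : ℕ∞) φ → HasCompactSupport φ →
      tsupport φ ⊆ Ω → ∫ x in Ω, (⟪F x, gradient φ x⟫ + G x * φ x) = 0)
    (hφ : ContDiff ℝ 1 φ) (hc : HasCompactSupport φ) (hs : tsupport φ ⊆ Ω) :
    ∫ x in Ω, (⟪F x, gradient φ x⟫ + G x * φ x) = 0 := by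
  obtain ⟨K, hKc, hKΩ, hφK, happ⟩ := exists_smooth_approx hΩ hφ hc hs
  obtain ⟨C, hC⟩ := hb K hKc hKΩ
  obtain ⟨D, hD⟩ := exists_gradient_bound hφ hKc
  choose ψ hψ hψK hψφ using fun n : ℕ => happ (1 / (n + 1)) (by positivity)
  have hlim : Tendsto (fun n : ℕ => (1 : ℝ) / (n + 1)) atTop (𝓝 0) :=
    tendsto_one_div_add_atTop_nhds_zero_nat
  have hgrad : ∀ n x, ‖gradient (ψ n) x - gradient φ x‖ ≤ 1 / (n + 1) := fun n x => by
    rw [norm_gradient_sub, ← dist_eq_norm]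
    exact (hψφ n x).2
  have hψ1 : ∀ n, ContDiff ℝ 1 (ψ n) := fun n => (hψ n).of_le (by exact_mod_cast le_top)
  have hle : ∀ n : ℕ, (1 : ℝ) / (n + 1) ≤ 1 := fun n => by
    rw [div_le_one (by positivity)]
    linarith [n.cast_nonneg (α := ℝ)]
  have hDψ : ∀ n, ∀ x ∈ K, ‖gradient (ψ n) x‖ ≤ D + 1 ∧ |ψ n x| ≤ D + 1 := by
    intro n x hx
    constructor
    · have := norm_le_norm_add_norm_sub' (gradient (ψ n) x) (gradient φ x)
      linarith [hgrad n x, hle n, (hD x hx).1]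
    · have h1 := (hψφ n x).1
      rw [Real.dist_eq] at h1
      have := abs_sub_abs_le_abs_sub (ψ n x) (φ x)
      linarith [hle n, (hD x hx).2]
  have hT := tendsto_integral_of_dominated_convergence (μ := volume.restrict Ω)
    (F := fun n x => ⟪F x, gradient (ψ n) x⟫ + G x * ψ n x)
    (f := fun x => ⟪F x, gradient φ x⟫ + G x * φ x)
    (K.indicator fun _ => C * (D + 1) + C * (D + 1))
    (fun n => aestronglyMeasurable_inner_gradient_add_mul hF hG (hψ1 n))
    (integrable_indicator_const_of_isCompact hKc _)
    (fun n => Eventually.of_forall (norm_inner_gradient_add_mul_le hC (hψK n) (hDψ n)))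
    (Eventually.of_forall fun x => by
      have h1 : Tendsto (fun n => gradient (ψ n) x) atTop (𝓝 (gradient φ x)) := by
        rw [tendsto_iff_norm_sub_tendsto_zero]
        exact squeeze_zero (fun _ => norm_nonneg _) (fun n => hgrad n x) hlim
      have h2 : Tendsto (fun n => ψ n x) atTop (𝓝 (φ x)) := by
        rw [tendsto_iff_dist_tendsto_zero]
        exact squeeze_zero (fun _ => dist_nonneg) (fun n => (hψφ n x).1) hlim
      exact (tendsto_const_nhds.inner h1).add (h2.const_mul _))
  have hz : ∀ n, ∫ x in Ω, (⟪F x, gradient (ψ n) x⟫ + G x * ψ n x) = 0 := fun n =>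
    h _ (hψ n) (hKc.of_isClosed_subset (isClosed_tsupport _) (hψK n)) ((hψK n).trans hKΩ)
  simp only [hz] at hT
  exact tendsto_nhds_unique hT tendsto_const_nhds |>.symm ▸ rfl

end Flux

section WeakSol

variable {d : ℕ} {p : ℝ} {V : EuclideanSpace ℝ (Fin d) → ℝ} {Ω : Set (EuclideanSpace ℝ (Fin d))}
  {u v : EuclideanSpace ℝ (Fin d) → ℝ}

theorem gradient_const_mul_of_differentiableAt {x : EuclideanSpace ℝ (Fin d)}
    (h : DifferentiableAt ℝ u x) (c : ℝ) :
    gradient (fun y => c * u y) x = c • gradient u x := by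
  simp [gradient, fderiv_const_mul h]

theorem IsPosWeakSol.const_mul (hΩ : IsOpen Ω) (hu : IsPosWeakSol p V Ω u) {c : ℝ} (hc : 0 < c) :
    IsPosWeakSol p V Ω fun x => c * u x := by
  obtain ⟨h1, h2, h3⟩ := hu
  refine ⟨contDiffOn_const.mul h1, fun x hx => mul_pos hc (h2 x hx), fun φ hφ hcs hs => ?_⟩
  have h := h3 φ hφ hcs hs
  rw [← mul_zero (c ^ (p - 2) * c), ← h, ← integral_const_mul]
  refine setIntegral_congr_fun hΩ.measurableSet fun x hx => ?_
  have hd : DifferentiableAt ℝ u x :=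
    (h1.differentiableOn one_ne_zero).differentiableAt (hΩ.mem_nhds hx)
  simp only [gradient_const_mul_of_differentiableAt hd, norm_smul, abs_mul, Real.norm_eq_abs,
    abs_of_pos hc, real_inner_smul_left]
  rw [Real.mul_rpow hc.le (norm_nonneg _), Real.mul_rpow hc.le (abs_nonneg _)]
  ring

theorem IsPosWeakSol.aestronglyMeasurable_flux (hΩ : IsOpen Ω) (hu : IsPosWeakSol p V Ω u) :
    AEStronglyMeasurable (fun x => ‖gradient u x‖ ^ (p - 2) • gradient u x)
      (volume.restrict Ω) := by
  have h := (continuousOn_gradient hΩ hu.1).aestronglyMeasurable (μ := volume) hΩ.measurableSet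
  exact (h.norm.aemeasurable.pow_const _).aestronglyMeasurable.smul h

theorem IsPosWeakSol.aestronglyMeasurable_potential (hΩ : IsOpen Ω) (hV : Measurable V)
    (hu : IsPosWeakSol p V Ω u) :
    AEStronglyMeasurable (fun x => V x * |u x| ^ (p - 2) * u x) (volume.restrict Ω) := by
  have h := hu.1.continuousOn.aestronglyMeasurable (μ := volume) hΩ.measurableSet
  exact (hV.aestronglyMeasurable.mul
    (h.norm.aemeasurable.pow_const (p - 2)).aestronglyMeasurable).mul h

theorem IsPosWeakSol.exists_bound (hΩ : IsOpen Ω) (hp : 1 < p)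
    (hVloc : ∀ K, IsCompact K → K ⊆ Ω → ∃ M : ℝ, ∀ x ∈ K, |V x| ≤ M)
    (hu : IsPosWeakSol p V Ω u) {K : Set (EuclideanSpace ℝ (Fin d))} (hK : IsCompact K)
    (hKΩ : K ⊆ Ω) :
    ∃ C, ∀ x ∈ K, ‖‖gradient u x‖ ^ (p - 2) • gradient u x‖ ≤ C ∧
      |V x * |u x| ^ (p - 2) * u x| ≤ C := by
  obtain ⟨M, hM⟩ := hVloc K hK hKΩ
  obtain ⟨C₁, h₁⟩ := hK.exists_bound_of_continuousOn ((continuousOn_gradient hΩ hu.1).mono hKΩ)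
  obtain ⟨C₂, h₂⟩ := hK.exists_bound_of_continuousOn (hu.1.continuousOn.mono hKΩ)
  have key : ∀ t : ℝ, 0 ≤ t → t ^ (p - 2) * t = t ^ (p - 1) := fun t ht => by
    rcases ht.eq_or_lt with rfl | ht
    · rw [mul_zero, Real.zero_rpow (by linarith)]
    · rw [← Real.rpow_add_one ht.ne']; ring_nf
  refine ⟨max (C₁ ^ (p - 1)) (M * C₂ ^ (p - 1)), fun x hx => ⟨?_, ?_⟩⟩
  · refine le_max_of_le_left ?_
    rw [norm_smul, Real.norm_of_nonneg (by positivity), key _ (norm_nonneg _)]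
    exact Real.rpow_le_rpow (norm_nonneg _) (h₁ x hx) (by linarith)
  · refine le_max_of_le_right ?_
    rw [mul_assoc, abs_mul, abs_mul, abs_of_nonneg (Real.rpow_nonneg (abs_nonneg (u x)) _),
      key _ (abs_nonneg _)]
    have hM0 : 0 ≤ M := (abs_nonneg _).trans (hM x hx)
    have := Real.rpow_le_rpow (norm_nonneg _) (h₂ x hx) (by linarith : 0 ≤ p - 1)
    exact mul_le_mul (hM x hx) this (by positivity) hM0

theorem IsPosWeakSol.integral_eq_zero (hΩ : IsOpen Ω) (hp : 1 < p) (hV : Measurable V)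
    (hVloc : ∀ K, IsCompact K → K ⊆ Ω → ∃ M : ℝ, ∀ x ∈ K, |V x| ≤ M)
    (hu : IsPosWeakSol p V Ω u) {φ : EuclideanSpace ℝ (Fin d) → ℝ} (hφ : ContDiff ℝ 1 φ)
    (hc : HasCompactSupport φ) (hs : tsupport φ ⊆ Ω) :
    ∫ x in Ω, (⟪‖gradient u x‖ ^ (p - 2) • gradient u x, gradient φ x⟫ +
      V x * |u x| ^ (p - 2) * u x * φ x) = 0 := by
  refine integral_inner_gradient_add_mul_eq_zero hΩ (hu.aestronglyMeasurable_flux hΩ)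
    (hu.aestronglyMeasurable_potential hΩ hV) (fun K => hu.exists_bound hΩ hp hVloc)
    (fun φ h1 h2 h3 => ?_) hφ hc hs
  simp only [real_inner_smul_left]
  exact hu.2.2 φ h1 h2 h3

theorem IsPosWeakSol.integrable (hΩ : IsOpen Ω) (hp : 1 < p) (hV : Measurable V)
    (hVloc : ∀ K, IsCompact K → K ⊆ Ω → ∃ M : ℝ, ∀ x ∈ K, |V x| ≤ M)
    (hu : IsPosWeakSol p V Ω u) {φ : EuclideanSpace ℝ (Fin d) → ℝ} (hφ : ContDiff ℝ 1 φ)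
    (hc : HasCompactSupport φ) (hs : tsupport φ ⊆ Ω) :
    Integrable (fun x => ⟪‖gradient u x‖ ^ (p - 2) • gradient u x, gradient φ x⟫ +
      V x * |u x| ^ (p - 2) * u x * φ x) (volume.restrict Ω) := by
  obtain ⟨C, hC⟩ := hu.exists_bound hΩ hp hVloc hc.isCompact hs
  exact integrable_inner_gradient_add_mul (hu.aestronglyMeasurable_flux hΩ)
    (hu.aestronglyMeasurable_potential hΩ hV) hc.isCompact hC hφ subset_rfl

theorem picone_identity {E : Type*} [NormedAddCommGroup E] [InnerProductSpace ℝ E] {p s t e k k' : ℝ}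
    (hp : 1 < p) (hs : 0 < s) (ht : 0 < t) (he : t ^ p * e = s ^ p) (a b : E) :
    ‖s • a‖ ^ (p - 2) * (s * (k' * ⟪s • a, a - b⟫) + k * ⟪s • a, s • a⟫) -
      ‖t • b‖ ^ (p - 2) * (t * ((p * e * k + e * k') * ⟪t • b, a - b⟫) +
        e * k * ⟪t • b, t • b⟫) =
    s ^ p * (k' * ⟪‖a‖ ^ (p - 2) • a - ‖b‖ ^ (p - 2) • b, a - b⟫ +
      k * (‖a‖ ^ p + (p - 1) * ‖b‖ ^ p - p * (‖b‖ ^ (p - 2) * ⟪b, a⟫))) := by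
  have ha := norm_rpow_sub_two_mul_sq hp a
  have hb := norm_rpow_sub_two_mul_sq hp b
  have h1 : ∀ x : ℝ, 0 < x → x ^ (p - 2) * x ^ 2 = x ^ p := fun x hx => by
    rw [← Real.rpow_natCast, ← Real.rpow_add hx]
    norm_num
  rw [← h1 s hs, ← h1 t ht] at he
  rw [← h1 s hs, ← ha, ← hb]
  simp only [norm_smul, Real.norm_of_nonneg hs.le, Real.norm_of_nonneg ht.le, inner_sub_left,
    inner_sub_right, real_inner_smul_left, real_inner_self_eq_norm_sq,
    real_inner_comm a b]
  rw [Real.mul_rpow hs.le (norm_nonneg _), Real.mul_rpow ht.le (norm_nonneg _)]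
  linear_combination (-‖b‖ ^ (p - 2) * ((p * k + k') * (⟪a, b⟫ - ‖b‖ ^ 2) + k * ‖b‖ ^ 2)) * he

theorem contDiff_indicator_of_eqOn_zero {E : Type*} [NormedAddCommGroup E] [NormedSpace ℝ E]
    {Ω K S : Set E} {f : E → ℝ} (hΩ : IsOpen Ω) (hK : K ⊆ Ω) (hf : ContDiffOn ℝ 1 f Ω)
    (hS : IsClosed S) (hSK : S ⊆ interior K) (h0 : ∀ x ∈ K, x ∉ S → f x = 0) :
    ContDiff ℝ 1 (K.indicator f) ∧ tsupport (K.indicator f) ⊆ S := by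
  have hz : ∀ x, x ∉ S → K.indicator f x = 0 := fun x hx => by
    by_cases hxK : x ∈ K
    · rw [indicator_of_mem hxK, h0 x hxK hx]
    · rw [indicator_of_notMem hxK]
  refine ⟨contDiff_iff_contDiffAt.2 fun x => ?_,
    closure_minimal (fun x hx => by_contra fun h => hx (hz x h)) hS⟩
  by_cases hx : x ∈ S
  · have h : K.indicator f =ᶠ[𝓝 x] f := by
      filter_upwards [isOpen_interior.mem_nhds (hSK hx)] with y hy
      rw [indicator_of_mem (interior_subset hy)]
    exact (hf.contDiffAt (hΩ.mem_nhds (hK (interior_subset (hSK hx))))).congr_of_eventuallyEq h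
  · have h : K.indicator f =ᶠ[𝓝 x] fun _ => 0 := by
      filter_upwards [hS.isOpen_compl.mem_nhds hx] with y hy using hz y hy
    exact contDiffAt_const.congr_of_eventuallyEq h

theorem expNegInvGlue.hasDerivAt (t : ℝ) :
    HasDerivAt expNegInvGlue (t⁻¹ ^ 2 * expNegInvGlue t) t := by
  simpa using expNegInvGlue.hasDerivAt_polynomial_eval_inv_mul 1 t

theorem picone_identity_logSub {p : ℝ} (hp : 1 < p) {x : EuclideanSpace ℝ (Fin d)}
    (hu : DifferentiableAt ℝ u x) (hv : DifferentiableAt ℝ v x) (hu0 : 0 < u x) (hv0 : 0 < v x)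
    {k : ℝ → ℝ} {k' : ℝ} (hk : HasDerivAt k k' (Real.log (u x) - Real.log (v x))) {c : ℝ} :
    (⟪‖gradient u x‖ ^ (p - 2) • gradient u x,
        gradient (fun y => u y * k (Real.log (u y) - Real.log (v y))) x⟫ +
        c * |u x| ^ (p - 2) * u x * (u x * k (Real.log (u x) - Real.log (v x)))) -
      (⟪‖gradient v x‖ ^ (p - 2) • gradient v x,
        gradient (fun y => v y * (Real.exp (p * (Real.log (u y) - Real.log (v y))) *
          k (Real.log (u y) - Real.log (v y)))) x⟫ +
        c * |v x| ^ (p - 2) * v x * (v x * (Real.exp (p * (Real.log (u x) - Real.log (v x))) *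
          k (Real.log (u x) - Real.log (v x))))) =
    u x ^ p * (k' * ⟪‖(u x)⁻¹ • gradient u x‖ ^ (p - 2) • (u x)⁻¹ • gradient u x -
        ‖(v x)⁻¹ • gradient v x‖ ^ (p - 2) • (v x)⁻¹ • gradient v x,
        (u x)⁻¹ • gradient u x - (v x)⁻¹ • gradient v x⟫ +
      k (Real.log (u x) - Real.log (v x)) * (‖(u x)⁻¹ • gradient u x‖ ^ p +
        (p - 1) * ‖(v x)⁻¹ • gradient v x‖ ^ p - p * (‖(v x)⁻¹ • gradient v x‖ ^ (p - 2) *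
          ⟪(v x)⁻¹ • gradient v x, (u x)⁻¹ • gradient u x⟫))) := by
  have he : v x ^ p * Real.exp (p * (Real.log (u x) - Real.log (v x))) = u x ^ p := by
    rw [Real.rpow_def_of_pos hu0, Real.rpow_def_of_pos hv0, ← Real.exp_add]
    ring_nf
  have hw : HasFDerivAt (fun y => Real.log (u y) - Real.log (v y))
      ((u x)⁻¹ • fderiv ℝ u x - (v x)⁻¹ • fderiv ℝ v x) x :=
    (hu.hasFDerivAt.log hu0.ne').sub (hv.hasFDerivAt.log hv0.ne')
  have hkw := hk.comp_hasFDerivAt x hw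
  have hew := (hw.const_mul p).exp
  have h1 := hu.hasFDerivAt.mul hkw
  have h2 := hv.hasFDerivAt.mul (hew.mul hkw)
  have key := picone_identity (k := k (Real.log (u x) - Real.log (v x))) (k' := k') hp hu0 hv0 he
    ((u x)⁻¹ • gradient u x) ((v x)⁻¹ • gradient v x)
  rw [smul_inv_smul₀ hu0.ne', smul_inv_smul₀ hv0.ne'] at key
  rw [← key]
  have hc : ∀ s : ℝ, 0 < s → |s| ^ (p - 2) * s * s = s ^ p := fun s hs => by
    rw [abs_of_pos hs, ← Real.rpow_add_one hs.ne', ← Real.rpow_add_one hs.ne']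
    ring_nf
  have hcu := hc _ hu0
  have hcv := hc _ hv0
  have e1 := h1.fderiv
  have e2 := h2.fderiv
  simp only [Function.comp_def] at e1 e2
  have i1 : ∀ X, ⟪X, gradient (fun y => u y * k (Real.log (u y) - Real.log (v y))) x⟫ =
      u x * (k' * ⟪X, (u x)⁻¹ • gradient u x - (v x)⁻¹ • gradient v x⟫) +
        k (Real.log (u x) - Real.log (v x)) * ⟪X, gradient u x⟫ := fun X => by
    rw [inner_gradient_right]
    erw [e1]
    simp only [inner_sub_right, real_inner_smul_right, inner_gradient_right]
    simp
  have i2 : ∀ X, ⟪X, gradient (fun y => v y * (Real.exp (p * (Real.log (u y) - Real.log (v y))) *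
          k (Real.log (u y) - Real.log (v y)))) x⟫ =
      v x * ((p * Real.exp (p * (Real.log (u x) - Real.log (v x))) *
        k (Real.log (u x) - Real.log (v x)) +
        Real.exp (p * (Real.log (u x) - Real.log (v x))) * k') *
          ⟪X, (u x)⁻¹ • gradient u x - (v x)⁻¹ • gradient v x⟫) +
        Real.exp (p * (Real.log (u x) - Real.log (v x))) *
          k (Real.log (u x) - Real.log (v x)) * ⟪X, gradient v x⟫ := fun X => by
    rw [inner_gradient_right]
    erw [e2]
    simp only [inner_sub_right, real_inner_smul_right, inner_gradient_right]
    simp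
    ring
  rw [i1, i2]
  simp only [real_inner_smul_left]
  linear_combination (c * k (Real.log (u x) - Real.log (v x))) * hcu -
    (c * Real.exp (p * (Real.log (u x) - Real.log (v x))) *
      k (Real.log (u x) - Real.log (v x))) * hcv -
    (c * k (Real.log (u x) - Real.log (v x))) * he

/-- Weak comparison principle for positive solutions. -/
theorem IsPosWeakSol.le_of_lt_on_frontier (hd : 0 < d) (hΩ : IsOpen Ω) (hp : 1 < p)
    (hV : Measurable V) (hVloc : ∀ K, IsCompact K → K ⊆ Ω → ∃ M : ℝ, ∀ x ∈ K, |V x| ≤ M)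
    (hu : IsPosWeakSol p V Ω u) (hv : IsPosWeakSol p V Ω v)
    {K : Set (EuclideanSpace ℝ (Fin d))} (hK : IsCompact K) (hKΩ : K ⊆ Ω)
    (hlt : ∀ x ∈ K, x ∉ interior K → u x < v x) : ∀ x ∈ K, u x ≤ v x := by
  let w : EuclideanSpace ℝ (Fin d) → ℝ := fun x => Real.log (u x) - Real.log (v x)
  have hw : ContDiffOn ℝ 1 w Ω :=
    (hu.1.log fun x hx => (hu.2.1 x hx).ne').sub (hv.1.log fun x hx => (hv.2.1 x hx).ne')
  have hwc : ContinuousOn w K := hw.continuousOn.mono hKΩ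
  have hlog : ∀ x ∈ Ω, u x < v x → w x < 0 := fun x hx h =>
    sub_neg.2 (Real.log_lt_log (hu.2.1 x hx) h)
  have hint : ∀ x ∈ K, 0 ≤ w x → x ∈ interior K := fun x hx h =>
    by_contra fun hn => (hlog x (hKΩ hx) (hlt x hx hn)).not_ge h
  let S : Set (EuclideanSpace ℝ (Fin d)) := K ∩ w ⁻¹' Ici 0
  have hS : IsClosed S := hwc.preimage_isClosed_of_isClosed hK.isClosed isClosed_Ici
  have hSK : S ⊆ interior K := fun x hx => hint x hx.1 hx.2
  have hSc : IsCompact S := hK.of_isClosed_subset hS inter_subset_left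
  have hSΩ : S ⊆ Ω := inter_subset_left.trans hKΩ
  have hgl : ContDiff ℝ 1 expNegInvGlue := expNegInvGlue.contDiff (n := 1)
  have hzero : ∀ x ∈ K, x ∉ S → expNegInvGlue (w x) = 0 := fun x hx hxS =>
    expNegInvGlue.zero_of_nonpos (not_le.1 fun h => hxS ⟨hx, h⟩).le
  let f₁ : EuclideanSpace ℝ (Fin d) → ℝ := fun y => u y * expNegInvGlue (w y)
  let f₂ : EuclideanSpace ℝ (Fin d) → ℝ := fun y =>
    v y * (Real.exp (p * w y) * expNegInvGlue (w y))
  obtain ⟨hφ₁, hs₁⟩ := contDiff_indicator_of_eqOn_zero (f := f₁) hΩ hKΩ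
    (hu.1.mul (hgl.comp_contDiffOn hw)) hS hSK (fun x hx hxS => by simp [f₁, hzero x hx hxS])
  obtain ⟨hφ₂, hs₂⟩ := contDiff_indicator_of_eqOn_zero (f := f₂) hΩ hKΩ
    (hv.1.mul ((contDiffOn_const.mul hw).exp.mul (hgl.comp_contDiffOn hw))) hS hSK
    (fun x hx hxS => by simp [f₂, hzero x hx hxS])
  set φ₁ := K.indicator f₁
  set φ₂ := K.indicator f₂
  have hc₁ : HasCompactSupport φ₁ := hSc.of_isClosed_subset (isClosed_tsupport _) hs₁
  have hc₂ : HasCompactSupport φ₂ := hSc.of_isClosed_subset (isClosed_tsupport _) hs₂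
  have hI₁ := hu.integrable hΩ hp hV hVloc hφ₁ hc₁ (hs₁.trans hSΩ)
  have hI₂ := hv.integrable hΩ hp hV hVloc hφ₂ hc₂ (hs₂.trans hSΩ)
  have hint0 := integral_sub hI₁ hI₂
  rw [hu.integral_eq_zero hΩ hp hV hVloc hφ₁ hc₁ (hs₁.trans hSΩ),
    hv.integral_eq_zero hΩ hp hV hVloc hφ₂ hc₂ (hs₂.trans hSΩ), sub_zero] at hint0
  have hsub := hI₁.sub hI₂
  set T : EuclideanSpace ℝ (Fin d) → ℝ := fun x =>
    (⟪‖gradient u x‖ ^ (p - 2) • gradient u x, gradient φ₁ x⟫ +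
      V x * |u x| ^ (p - 2) * u x * φ₁ x) -
    (⟪‖gradient v x‖ ^ (p - 2) • gradient v x, gradient φ₂ x⟫ +
      V x * |v x| ^ (p - 2) * v x * φ₂ x) with hT
  have hdu : ∀ x ∈ Ω, DifferentiableAt ℝ u x := fun x hx =>
    (hu.1.differentiableOn one_ne_zero).differentiableAt (hΩ.mem_nhds hx)
  have hdv : ∀ x ∈ Ω, DifferentiableAt ℝ v x := fun x hx =>
    (hv.1.differentiableOn one_ne_zero).differentiableAt (hΩ.mem_nhds hx)
  have hTin : ∀ x ∈ interior K, T x =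
      u x ^ p * (((w x)⁻¹ ^ 2 * expNegInvGlue (w x)) *
        ⟪‖(u x)⁻¹ • gradient u x‖ ^ (p - 2) • (u x)⁻¹ • gradient u x -
          ‖(v x)⁻¹ • gradient v x‖ ^ (p - 2) • (v x)⁻¹ • gradient v x,
          (u x)⁻¹ • gradient u x - (v x)⁻¹ • gradient v x⟫ +
        expNegInvGlue (w x) * (‖(u x)⁻¹ • gradient u x‖ ^ p +
          (p - 1) * ‖(v x)⁻¹ • gradient v x‖ ^ p - p * (‖(v x)⁻¹ • gradient v x‖ ^ (p - 2) *
            ⟪(v x)⁻¹ • gradient v x, (u x)⁻¹ • gradient u x⟫))) := by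
    intro x hx
    have hxΩ := hKΩ (interior_subset hx)
    have hev : ∀ f : EuclideanSpace ℝ (Fin d) → ℝ, K.indicator f =ᶠ[𝓝 x] f := fun f => by
      filter_upwards [isOpen_interior.mem_nhds hx] with y hy
      rw [indicator_of_mem (interior_subset hy)]
    rw [← picone_identity_logSub (c := V x) hp (hdu x hxΩ) (hdv x hxΩ) (hu.2.1 x hxΩ)
      (hv.2.1 x hxΩ) (expNegInvGlue.hasDerivAt (w x)), hT]
    simp only [φ₁, φ₂, (hev f₁).gradient_eq, (hev f₂).gradient_eq, (hev f₁).eq_of_nhds,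
      (hev f₂).eq_of_nhds]
    rfl
  have hmono : ∀ a b : EuclideanSpace ℝ (Fin d),
      0 ≤ ⟪‖a‖ ^ (p - 2) • a - ‖b‖ ^ (p - 2) • b, a - b⟫ := fun a b => by
    rcases eq_or_ne a b with rfl | hab
    · simp
    · exact (inner_rpow_smul_sub_pos hp hab).le
  have hT0 : ∀ x, 0 ≤ T x := by
    intro x
    by_cases hx : x ∈ interior K
    · rw [hTin x hx]
      have h1 := expNegInvGlue.nonneg (w x)
      have h2 := (hu.2.1 x (hKΩ (interior_subset hx))).le
      exact mul_nonneg (Real.rpow_nonneg h2 _) (add_nonneg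
        (mul_nonneg (mul_nonneg (sq_nonneg _) h1) (hmono _ _))
        (mul_nonneg h1 (sub_nonneg.2 (mul_rpow_mul_inner_le hp _ _))))
    · have h1 : x ∉ tsupport φ₁ := fun h => hx (hSK (hs₁ h))
      have h2 : x ∉ tsupport φ₂ := fun h => hx (hSK (hs₂ h))
      simp only [hT, gradient_eq_zero_of_notMem_tsupport h1, gradient_eq_zero_of_notMem_tsupport h2,
        image_eq_zero_of_notMem_tsupport h1, image_eq_zero_of_notMem_tsupport h2, inner_zero_right,
        mul_zero, add_zero, sub_zero, le_refl]
  have hTae : T =ᵐ[volume.restrict Ω] 0 :=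
    (integral_eq_zero_iff_of_nonneg hT0 hsub).1 hint0
  have hTpos : ∀ x ∈ interior K, 0 < w x → fderiv ℝ w x ≠ 0 → 0 < T x := by
    intro x hx hwx hne
    have hxΩ := hKΩ (interior_subset hx)
    rw [hTin x hx]
    have h1 := expNegInvGlue.pos_of_pos hwx
    have h2 := hu.2.1 x hxΩ
    have hab : (u x)⁻¹ • gradient u x ≠ (v x)⁻¹ • gradient v x := by
      intro h
      refine hne ?_
      have hfd : HasFDerivAt w ((u x)⁻¹ • fderiv ℝ u x - (v x)⁻¹ • fderiv ℝ v x) x :=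
        ((hdu x hxΩ).hasFDerivAt.log h2.ne').sub
          ((hdv x hxΩ).hasFDerivAt.log (hv.2.1 x hxΩ).ne')
      rw [hfd.fderiv, ← toDual_gradient, ← toDual_gradient, sub_eq_zero]
      simpa using congrArg (InnerProductSpace.toDual ℝ _) h
    refine mul_pos (Real.rpow_pos_of_pos h2 _) (add_pos_of_pos_of_nonneg
      (mul_pos (mul_pos (by positivity) h1) (inner_rpow_smul_sub_pos hp hab))
      (mul_nonneg h1.le (sub_nonneg.2 (mul_rpow_mul_inner_le hp _ _))))
  have hiΩ : interior K ⊆ Ω := interior_subset.trans hKΩ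
  have hD : ∀ x ∈ interior K, 0 < w x → fderiv ℝ w x = 0 := by
    let N : Set (EuclideanSpace ℝ (Fin d)) :=
      interior K ∩ (fun x => (w x, fderiv ℝ w x)) ⁻¹' (Ioi 0 ×ˢ {0}ᶜ)
    have hN : IsOpen N := ((hw.continuousOn.mono hiΩ).prodMk
      ((hw.continuousOn_fderiv_of_isOpen hΩ le_rfl).mono hiΩ)).isOpen_inter_preimage
        isOpen_interior (isOpen_Ioi.prod isOpen_compl_singleton)
    have hN0 : volume N = 0 := by
      rw [← Measure.restrict_eq_self volume (inter_subset_left.trans hiΩ : N ⊆ Ω)]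
      refine measure_mono_null (fun x hx => ?_) (ae_iff.1 hTae)
      exact (hTpos x hx.1 hx.2.1 hx.2.2).ne'
    intro x hx hwx
    by_contra hne
    have : x ∈ N := ⟨hx, hwx, hne⟩
    rw [(hN.measure_eq_zero_iff volume).1 hN0] at this
    exact this
  by_contra! hcon
  obtain ⟨x₁, hx₁, hlt₁⟩ := hcon
  obtain ⟨x₀, hx₀, hmax⟩ := hK.exists_isMaxOn ⟨x₁, hx₁⟩ hwc
  have hw₀ : 0 < w x₀ := (sub_pos.2 (Real.log_lt_log (hv.2.1 x₁ (hKΩ hx₁)) hlt₁)).trans_le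
    (hmax hx₁)
  let U : Set (EuclideanSpace ℝ (Fin d)) := interior K ∩ w ⁻¹' Ioi 0
  have hU : IsOpen U :=
    (hw.continuousOn.mono hiΩ).isOpen_inter_preimage isOpen_interior isOpen_Ioi
  have hlevel : K ∩ w ⁻¹' {w x₀} = U ∩ w ⁻¹' {w x₀} := by
    ext x
    refine ⟨fun ⟨h1, h2⟩ => ?_, fun ⟨h1, h2⟩ => ⟨interior_subset h1.1, h2⟩⟩
    have hpos : 0 < w x := by rw [show w x = w x₀ from h2]; exact hw₀
    exact ⟨⟨hint x h1 hpos.le, hpos⟩, h2⟩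
  have hclopen : IsClopen (K ∩ w ⁻¹' {w x₀}) := by
    refine ⟨hwc.preimage_isClosed_of_isClosed hK.isClosed isClosed_singleton, ?_⟩
    rw [hlevel]
    exact hU.isOpen_inter_preimage_of_fderiv_eq_zero
      ((hw.differentiableOn one_ne_zero).mono (inter_subset_left.trans hiΩ))
      (fun x hx => hD x hx.1 hx.2) _
  have huniv := hclopen.eq_univ ⟨x₀, hx₀, rfl⟩
  have hKuniv : K = univ := univ_subset_iff.1 (huniv ▸ inter_subset_left)
  have : Nonempty (Fin d) := ⟨⟨0, hd⟩⟩
  exact noncompact_univ _ (hKuniv ▸ hK)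

end WeakSol

theorem exists_tendsto_ofReal_of_monotoneOn_or_antitoneOn {f : ℝ → ℝ} {r : ℝ} (hr : 0 < r)
    (hf : MonotoneOn f (Ioo 0 r) ∨ AntitoneOn f (Ioo 0 r)) :
    ∃ l : ℝ≥0∞, Tendsto (fun r => ENNReal.ofReal (f r)) (𝓝[>] 0) (𝓝 l) := by
  rcases hf with h | h
  · exact ⟨_, MonotoneOn.tendsto_nhdsWithin_Ioo_right (nonempty_Ioo.2 hr)
      (fun x hx y hy hxy => ENNReal.ofReal_le_ofReal (h hx hy hxy)) (OrderBot.bddBelow _)⟩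
  · exact ⟨_, AntitoneOn.tendsto_nhdsWithin_Ioo_right (nonempty_Ioo.2 hr)
      (fun x hx y hy hxy => ENNReal.ofReal_le_ofReal (h hx hy hxy)) (OrderTop.bddAbove _)⟩

/-- Weak comparison principle on a spherical shell. -/
theorem IsPosWeakSol.le_of_lt_on_spheres {d : ℕ} (hd : 0 < d) {p : ℝ} (hp : 1 < p)
    {V : EuclideanSpace ℝ (Fin d) → ℝ} {Ω : Set (EuclideanSpace ℝ (Fin d))} (hΩ : IsOpen Ω)
    (hV : Measurable V) (hVloc : ∀ K, IsCompact K → K ⊆ Ω → ∃ M : ℝ, ∀ x ∈ K, |V x| ≤ M)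
    {u v : EuclideanSpace ℝ (Fin d) → ℝ}
    (hu : IsPosWeakSol p V Ω u) (hv : IsPosWeakSol p V Ω v) {a b c : ℝ} (hab : a < b)
    (hbc : b < c) (hs : ∀ x, a ≤ ‖x‖ → ‖x‖ ≤ c → x ∈ Ω)
    (ha : ∀ x, ‖x‖ = a → u x < v x) (hc : ∀ x, ‖x‖ = c → u x < v x) :
    ∀ x, ‖x‖ = b → u x ≤ v x := by
  intro x hx
  let K : Set (EuclideanSpace ℝ (Fin d)) := (fun x => ‖x‖) ⁻¹' Icc a c
  have hK : IsCompact K := (isCompact_closedBall 0 c).of_isClosed_subset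
    (isClosed_Icc.preimage continuous_norm) (fun x hx => mem_closedBall_zero_iff.2 hx.2)
  refine hu.le_of_lt_on_frontier hd hΩ hp hV hVloc hv hK (fun x hx => hs x hx.1 hx.2)
    (fun y hy hyi => ?_) x ⟨hab.le.trans_eq hx.symm, hx.trans_le hbc.le⟩
  rcases hy.1.eq_or_lt with h | h
  · exact ha y h.symm
  rcases hy.2.eq_or_lt with h' | h'
  · exact hc y h'
  · exact absurd (interior_maximal (preimage_mono Ioo_subset_Icc_self)
      (isOpen_Ioo.preimage continuous_norm) ⟨h, h'⟩) hyi

theorem stmt10 (d : ℕ) (hd : 2 ≤ d) (p : ℝ) (hp : 1 < p) (C₀ : ℝ) (hC₀ : 0 < C₀)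
    (V : EuclideanSpace ℝ (Fin d) → ℝ) (hVmeas : Measurable V)
    (hVloc : ∀ K : Set (EuclideanSpace ℝ (Fin d)), IsCompact K →
      K ⊆ ball (0 : EuclideanSpace ℝ (Fin d)) 1 \ {0} → ∃ M : ℝ, ∀ x ∈ K, |V x| ≤ M)
    (hFuchs : ∀ᵐ x ∂(volume.restrict (ball (0 : EuclideanSpace ℝ (Fin d)) 1 \ {0})),
      ‖x‖ ^ p * |V x| ≤ C₀)
    (u v : EuclideanSpace ℝ (Fin d) → ℝ)
    (hu : IsPosWeakSol p V (ball (0 : EuclideanSpace ℝ (Fin d)) 1 \ {0}) u)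
    (hv : IsPosWeakSol p V (ball (0 : EuclideanSpace ℝ (Fin d)) 1 \ {0}) v)
    (m M : ℝ → ℝ)
    (hm : ∀ r, m r = sInf ((fun x => u x / v x) '' sphere (0 : EuclideanSpace ℝ (Fin d)) r))
    (hM : ∀ r, M r = sSup ((fun x => u x / v x) '' sphere (0 : EuclideanSpace ℝ (Fin d)) r)) :
    ∃ r₀ : ℝ, 0 < r₀ ∧ r₀ < 1 ∧
      (MonotoneOn m (Ioo 0 r₀) ∨ AntitoneOn m (Ioo 0 r₀)) ∧
      (MonotoneOn M (Ioo 0 r₀) ∨ AntitoneOn M (Ioo 0 r₀)) ∧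
      (∃ lm : ℝ≥0∞, Tendsto (fun r => ENNReal.ofReal (m r)) (𝓝[>] 0) (𝓝 lm)) ∧
      (∃ lM : ℝ≥0∞, Tendsto (fun r => ENNReal.ofReal (M r)) (𝓝[>] 0) (𝓝 lM)) := by

  have hΩ : IsOpen (ball (0 : EuclideanSpace ℝ (Fin d)) 1 \ {0}) :=
    isOpen_ball.sdiff isClosed_singleton
  have hd0 : 0 < d := by omega
  have : Nonempty (Fin d) := ⟨⟨0, hd0⟩⟩
  have hmem : ∀ (x : EuclideanSpace ℝ (Fin d)), 0 < ‖x‖ → ‖x‖ < 1 →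
      x ∈ ball (0 : EuclideanSpace ℝ (Fin d)) 1 \ {0} := fun x h0 h1 =>
    ⟨mem_ball_zero_iff.2 h1, norm_pos_iff.1 h0⟩
  have hne : ∀ r : ℝ, 0 < r →
      ((fun x => u x / v x) '' sphere (0 : EuclideanSpace ℝ (Fin d)) r).Nonempty := fun r hr =>
    (NormedSpace.sphere_nonempty.2 hr.le).image _
  have hbelow : ∀ r : ℝ, 0 < r → r < 1 →
      ∀ y ∈ (fun x => u x / v x) '' sphere (0 : EuclideanSpace ℝ (Fin d)) r, 0 ≤ y := by
    rintro r hr hr1 _ ⟨x, hx, rfl⟩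
    rw [mem_sphere_zero_iff_norm] at hx
    have := hmem x (hx ▸ hr) (hx ▸ hr1)
    exact (div_pos (hu.2.1 x this) (hv.2.1 x this)).le
  have habove : ∀ r : ℝ, 0 < r → r < 1 →
      BddAbove ((fun x => u x / v x) '' sphere (0 : EuclideanSpace ℝ (Fin d)) r) := by
    intro r hr hr1
    have hsub : sphere (0 : EuclideanSpace ℝ (Fin d)) r ⊆ ball 0 1 \ {0} := fun x hx => by
      rw [mem_sphere_zero_iff_norm] at hx
      exact hmem x (hx ▸ hr) (hx ▸ hr1)
    exact (isCompact_sphere 0 r).bddAbove_image ((hu.1.continuousOn.mono hsub).div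
      (hv.1.continuousOn.mono hsub) fun x hx => (hv.2.1 x (hsub hx)).ne')
  have hqm : ∀ a b c, 0 < a → a < b → b < c → c < 1 → min (m a) (m c) ≤ m b := by
    intro a b c ha hab hbc hc
    refine le_of_forall_lt fun t ht => ?_
    obtain ⟨s, hts, hs⟩ := exists_between ht
    refine hts.trans_le ?_
    rw [hm b]
    refine le_csInf (hne b (ha.trans hab)) ?_
    rintro _ ⟨x, hx, rfl⟩
    rw [mem_sphere_zero_iff_norm] at hx
    have hxm := hmem x (by linarith) (by linarith)
    rcases le_or_gt s 0 with hs0 | hs0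
    · exact hs0.trans (div_pos (hu.2.1 x hxm) (hv.2.1 x hxm)).le
    have hside : ∀ r, 0 < r → r < 1 → s < m r → ∀ y, ‖y‖ = r → s * v y < u y := by
      intro r hr hr1 hsr y hy
      rw [← lt_div_iff₀ (hv.2.1 y (hmem y (hy ▸ hr) (hy ▸ hr1)))]
      refine hsr.trans_le ?_
      rw [hm r]
      exact csInf_le ⟨0, hbelow r hr hr1⟩ ⟨y, mem_sphere_zero_iff_norm.2 hy, rfl⟩
    rw [le_div_iff₀ (hv.2.1 x hxm)]
    exact (hv.const_mul hΩ hs0).le_of_lt_on_spheres hd0 hp hΩ hVmeas hVloc hu hab hbc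
      (fun y h1 h2 => hmem y (by linarith) (by linarith))
      (hside a ha (by linarith) (hs.trans_le (min_le_left _ _)))
      (hside c (by linarith) hc (hs.trans_le (min_le_right _ _))) x hx
  have hqM : ∀ a b c, 0 < a → a < b → b < c → c < 1 → M b ≤ max (M a) (M c) := by
    intro a b c ha hab hbc hc
    refine le_of_forall_gt fun t ht => ?_
    obtain ⟨s, hs, hst⟩ := exists_between ht
    refine lt_of_le_of_lt ?_ hst
    have hside : ∀ r, 0 < r → r < 1 → M r < s → ∀ y, ‖y‖ = r → u y / v y < s := by
      intro r hr hr1 hsr y hy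
      refine lt_of_le_of_lt ?_ hsr
      rw [hM r]
      exact le_csSup (habove r hr hr1) ⟨y, mem_sphere_zero_iff_norm.2 hy, rfl⟩
    have hside' : ∀ r, 0 < r → r < 1 → M r < s → ∀ y, ‖y‖ = r → u y < s * v y := by
      intro r hr hr1 hsr y hy
      rw [← div_lt_iff₀ (hv.2.1 y (hmem y (hy ▸ hr) (hy ▸ hr1)))]
      exact hside r hr hr1 hsr y hy
    have hsa := (le_max_left _ _).trans_lt hs
    have hsc := (le_max_right _ _).trans_lt hs
    have hs0 : 0 < s := by
      obtain ⟨_, y, hy, rfl⟩ := hne a ha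
      exact (hbelow a ha (by linarith) _ ⟨y, hy, rfl⟩).trans_lt
        (hside a ha (by linarith) hsa y (mem_sphere_zero_iff_norm.1 hy))
    rw [hM b]
    refine csSup_le (hne b (ha.trans hab)) ?_
    rintro _ ⟨x, hx, rfl⟩
    rw [mem_sphere_zero_iff_norm] at hx
    have hxm := hmem x (by linarith) (by linarith)
    rw [div_le_iff₀ (hv.2.1 x hxm)]
    exact hu.le_of_lt_on_spheres hd0 hp hΩ hVmeas hVloc (hv.const_mul hΩ hs0) hab hbc
      (fun y h1 h2 => hmem y (by linarith) (by linarith))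
      (hside' a ha (by linarith) hsa) (hside' c (by linarith) hc hsc) x hx
  obtain ⟨r₁, h₁, h₁', hmon⟩ := exists_monotoneOn_or_antitoneOn_of_min_le hqm
  obtain ⟨r₂, h₂, h₂', hMon⟩ := exists_monotoneOn_or_antitoneOn_of_min_le
    (f := fun r => OrderDual.toDual (M r)) hqM
  have hr : 0 < min r₁ r₂ := lt_min h₁ h₂
  have hm' := hmon (min r₁ r₂) (min_le_left _ _)
  have hM' : MonotoneOn M (Ioo 0 (min r₁ r₂)) ∨ AntitoneOn M (Ioo 0 (min r₁ r₂)) :=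
    (hMon (min r₁ r₂) (min_le_right _ _)).symm
  exact ⟨min r₁ r₂, hr, (min_le_left _ _).trans_lt h₁', hm', hM',
    exists_tendsto_ofReal_of_monotoneOn_or_antitoneOn hr hm',
    exists_tendsto_ofReal_of_monotoneOn_or_antitoneOn hr hM'⟩
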